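/- arXiv:2502.15523 — 4 statements merged into one kernel-verified Lean document; each statement's English description precedes it below -/
import Mathlib

section
/- For every δ ∈ (0,1) there exists a natural number n(δ) such that for every integer n > n(δ) there exists an instance of the hidden-action principal-agent problem with two outcomes and 2n + 1 actions for which OPT(δ) − (OPT − 2√δ + δ) ≤ √δ / n. -/
open scoped BigOperators

/-- An instance of a hidden-action principal-agent problem with action set `A`
and outcome set `O`. -/
structure PAInstance (A O : Type*) [Fintype A] [Fintype O] [Nonempty A] [Nonempty O] where
  /-- `F a ω` is the probability that action `a` results in outcome `ω`. -/
  F : A → O → ℝ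
  /-- principal's reward vector -/
  r : O → ℝ
  /-- agent's cost vector -/
  c : A → ℝ
  F_nonneg : ∀ a ω, 0 ≤ F a ω
  F_sum : ∀ a, ∑ ω, F a ω = 1
  r_mem : ∀ ω, r ω ∈ Set.Icc (0 : ℝ) 1
  c_mem : ∀ a, c a ∈ Set.Icc (0 : ℝ) 1
  /-- the opt-out action -/
  optOut : A
  optOut_cost : c optOut = 0
  optOut_reward : ∑ ω, F optOut ω * r ω = 0

namespace PAInstance

variable {A O : Type*} [Fintype A] [Fintype O] [Nonempty A] [Nonempty O]

/-- A contract is a vector of nonnegative payments, one per outcome. -/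
def IsContract (p : O → ℝ) : Prop := ∀ ω, 0 ≤ p ω

/-- Agent's expected utility `u^A(p, a) = F_a · p - c_a`. -/
def uA (I : PAInstance A O) (p : O → ℝ) (a : A) : ℝ := (∑ ω, I.F a ω * p ω) - I.c a

/-- Principal's expected utility `u^P(p, a) = F_a · (r - p)`. -/
def uP (I : PAInstance A O) (p : O → ℝ) (a : A) : ℝ := ∑ ω, I.F a ω * (I.r ω - p ω)

/-- The set of (exact) best responses `A(p)`. -/
def BR (I : PAInstance A O) (p : O → ℝ) : Set A := {a | ∀ a', I.uA p a' ≤ I.uA p a}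

/-- The set of `δ`-best responses
`A^δ(p) = {a : u^A(p,a) > max_{a'} u^A(p,a') - δ}`. -/
def dBR (I : PAInstance A O) (δ : ℝ) (p : O → ℝ) : Set A :=
  {a | ∀ a', I.uA p a' - δ < I.uA p a}

/-- `Ψ_δ(p) = min_{a ∈ A^δ(p)} u^P(p, a)`, the principal's robust utility in `p`. -/
noncomputable def Psi (I : PAInstance A O) (δ : ℝ) (p : O → ℝ) : ℝ :=
  sInf (I.uP p '' I.dBR δ p)

/-- `OPT(δ)`: the optimal δ-robust value. -/
noncomputable def OPTrob (I : PAInstance A O) (δ : ℝ) : ℝ :=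
  sSup {x | ∃ p, IsContract p ∧ x = I.Psi δ p}

/-- `OPT`: value of an optimal (non-robust) contract, where the agent breaks
ties in favor of the principal. -/
noncomputable def OPT (I : PAInstance A O) : ℝ :=
  sSup {x | ∃ p, IsContract p ∧ x = sSup (I.uP p '' I.BR p)}

/-- `SW = max_a (F_a · r - c_a)`, the maximum social welfare. -/
noncomputable def SW (I : PAInstance A O) : ℝ :=
  sSup (Set.range fun a => (∑ ω, I.F a ω * I.r ω) - I.c a)

end PAInstance

namespace PAInstance

section General

variable {A O : Type*} [Fintype A] [Fintype O] [Nonempty A] [Nonempty O]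

lemma uP_le_one (I : PAInstance A O) {p : O → ℝ} (hp : IsContract p) (a : A) :
    I.uP p a ≤ 1 := by
  unfold uP
  rw [← I.F_sum a]
  refine Finset.sum_le_sum fun ω _ => ?_
  have := hp ω
  have := (I.r_mem ω).2
  nlinarith [I.F_nonneg a ω]

lemma le_OPT (I : PAInstance A O) {p : O → ℝ} (hp : IsContract p) {a : A} (ha : a ∈ I.BR p) :
    I.uP p a ≤ I.OPT := by
  have hle : I.uP p a ≤ sSup (I.uP p '' I.BR p) :=
    le_csSup (Set.toFinite _).bddAbove (Set.mem_image_of_mem _ ha)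
  refine hle.trans (le_csSup ⟨1, ?_⟩ ⟨p, hp, rfl⟩)
  rintro x ⟨p', hp', rfl⟩
  refine Real.sSup_le ?_ zero_le_one
  rintro _ ⟨a', -, rfl⟩
  exact I.uP_le_one hp' a'

lemma OPTrob_le (I : PAInstance A O) {δ T : ℝ}
    (h : ∀ p, IsContract p → ∃ a ∈ I.dBR δ p, I.uP p a ≤ T) : I.OPTrob δ ≤ T := by
  refine csSup_le ⟨_, 0, fun _ => le_rfl, rfl⟩ ?_
  rintro x ⟨p, hp, rfl⟩
  obtain ⟨a, ha, haT⟩ := h p hp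
  exact (csInf_le (Set.toFinite _).bddBelow (Set.mem_image_of_mem _ ha)).trans haT

end General

/-- The costless instance with outcomes failure `0` (reward `0`) and success `1` (reward `1`),
where action `a` succeeds with probability `q a`. -/
def ofSuccessProb {A : Type*} [Fintype A] [Nonempty A] (q : A → ℝ)
    (hq : ∀ a, q a ∈ Set.Icc (0 : ℝ) 1) (a₀ : A) (h₀ : q a₀ = 0) : PAInstance A (Fin 2) where
  F a := ![1 - q a, q a]
  r := ![0, 1]
  c _ := 0
  F_nonneg a ω := by
    have := hq a
    fin_cases ω <;> simp [this.1, this.2]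
  F_sum a := by simp
  r_mem ω := by fin_cases ω <;> simp
  c_mem _ := by simp
  optOut := a₀
  optOut_cost := rfl
  optOut_reward := by simp [h₀]

section SuccessProb

variable {A : Type*} [Fintype A] [Nonempty A] (q : A → ℝ)
  (hq : ∀ a, q a ∈ Set.Icc (0 : ℝ) 1) (a₀ : A) (h₀ : q a₀ = 0)

lemma uA_ofSuccessProb (p : Fin 2 → ℝ) (a : A) :
    (ofSuccessProb q hq a₀ h₀).uA p a = p 0 + (p 1 - p 0) * q a := by
  simp [ofSuccessProb, uA]
  ring

lemma uP_ofSuccessProb (p : Fin 2 → ℝ) (a : A) :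
    (ofSuccessProb q hq a₀ h₀).uP p a = q a * (1 - (p 1 - p 0)) - p 0 := by
  simp [ofSuccessProb, uP]
  ring

lemma one_le_OPT_ofSuccessProb {a : A} (ha : q a = 1) :
    1 ≤ (ofSuccessProb q hq a₀ h₀).OPT := by
  have := (ofSuccessProb q hq a₀ h₀).le_OPT (p := 0) (a := a) (fun _ => le_rfl)
    (fun a' => by simp [uA_ofSuccessProb])
  simpa [uP_ofSuccessProb, ha] using this

/-- If for every slope `α ∈ (0, 1)` some action losing less than `δ` at that slope leaves the
principal at most `T`, then `OPT(δ) ≤ T`. -/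
lemma OPTrob_ofSuccessProb_le {δ T : ℝ} (hδ : 0 < δ) (hT : 0 ≤ T) {a₁ : A} (h₁ : q a₁ = 1)
    (h : ∀ α, 0 < α → α < 1 → ∃ a, α * (1 - q a) < δ ∧ q a * (1 - α) ≤ T) :
    (ofSuccessProb q hq a₀ h₀).OPTrob δ ≤ T := by
  refine OPTrob_le _ fun p hp => ?_
  have hp0 := hp 0
  simp only [dBR, Set.mem_ofPred_eq, uA_ofSuccessProb, uP_ofSuccessProb]
  generalize p 1 - p 0 = α
  rcases le_or_gt α 0 with hα | hα
  · refine ⟨a₀, fun a' => ?_, by rw [h₀]; linarith⟩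
    rw [h₀]
    nlinarith [(hq a').1]
  rcases le_or_gt 1 α with hα1 | hα1
  · refine ⟨a₁, fun a' => ?_, by rw [h₁]; linarith⟩
    rw [h₁]
    nlinarith [(hq a').2]
  · obtain ⟨a, ha, haT⟩ := h α hα hα1
    refine ⟨a, fun a' => ?_, by linarith⟩
    nlinarith [(hq a').2]

end SuccessProb

end PAInstance

/-- The grid of spacing `s / n` below `1`, clipped at `0`, whose last point is moved to `0`. -/
noncomputable def successGrid (s : ℝ) (n : ℕ) (j : Fin (2 * n + 1)) : ℝ :=
  if (j : ℕ) = 2 * n then 0 else max 0 (1 - s * j / n)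

lemma successGrid_mem {s : ℝ} (hs : 0 ≤ s) (n : ℕ) (j : Fin (2 * n + 1)) :
    successGrid s n j ∈ Set.Icc (0 : ℝ) 1 := by
  unfold successGrid
  split_ifs
  · simp
  · exact ⟨le_max_left _ _, max_le zero_le_one (sub_le_self _ (by positivity))⟩

lemma exists_successGrid {s : ℝ} (hs : 0 < s) {n : ℕ} (hn : 0 < n) {α : ℝ} (hα : 0 < α)
    (hα1 : α < 1) :
    ∃ j, α * (1 - successGrid s n j) < s ^ 2 ∧
      successGrid s n j * (1 - α) ≤ (1 - s) ^ 2 + s / n := by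
  have hn' : (0 : ℝ) < n := by exact_mod_cast hn
  have hε : 0 < s / n := by positivity
  set x : ℝ := n * s / α with hx
  have hx0 : 0 < x := by positivity
  have hxs : s * x / n = s ^ 2 / α := by
    rw [hx]
    field_simp
  have hk : 0 < ⌈x⌉₊ := Nat.ceil_pos.mpr hx0
  have hkx : ((⌈x⌉₊ - 1 : ℕ) : ℝ) < x := Nat.lt_ceil.mp (by omega)
  have hxk : x - 1 ≤ ((⌈x⌉₊ - 1 : ℕ) : ℝ) := by
    rw [Nat.cast_sub hk, Nat.cast_one]
    linarith [Nat.le_ceil x]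
  set k := ⌈x⌉₊ - 1
  obtain ⟨j, hj2n, hjx, hj⟩ : ∃ j : ℕ, j < 2 * n ∧ (j : ℝ) < x ∧
      (x - 1 ≤ (j : ℝ) ∨ (j : ℝ) = 2 * n - 1) := by
    by_cases h : k < 2 * n
    · exact ⟨k, h, hkx, Or.inl hxk⟩
    · refine ⟨2 * n - 1, by omega, lt_of_le_of_lt ?_ hkx, Or.inr ?_⟩
      · exact_mod_cast (by omega : 2 * n - 1 ≤ k)
      · rw [Nat.cast_sub (by omega)]
        push_cast
        ring
  have hval : successGrid s n ⟨j, by omega⟩ = max 0 (1 - s * j / n) := if_neg hj2n.ne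
  refine ⟨⟨j, by omega⟩, ?_, ?_⟩
  · have h1 : s * j / n < s ^ 2 / α := by
      rw [← hxs]
      gcongr
    have h2 := mul_lt_mul_of_pos_left h1 hα
    rw [mul_div_cancel₀ _ hα.ne'] at h2
    rw [hval]
    nlinarith [le_max_right 0 (1 - s * j / n)]
  · rw [hval]
    rcases le_total (1 - s * j / n) 0 with h | h
    · rw [max_eq_left h, zero_mul]
      positivity
    rw [max_eq_right h]
    rcases hj with hj | hj
    · have h1 : s ^ 2 / α - s / n ≤ s * j / n := by
        rw [← hxs, ← sub_div]
        gcongr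
        nlinarith
      have h2 : 2 * s ≤ α + s ^ 2 / α := by
        have : α + s ^ 2 / α - 2 * s = (α - s) ^ 2 / α := by
          field_simp
          ring
        have : 0 ≤ (α - s) ^ 2 / α := by positivity
        linarith
      have h3 : α * (s ^ 2 / α) = s ^ 2 := mul_div_cancel₀ _ hα.ne'
      nlinarith
    · have h1 : s * j / n = 2 * s - s / n := by
        rw [hj]
        field_simp
      nlinarith [sq_nonneg s]

/-- For every δ ∈ (0,1) there is `n(δ)` such that for all `n > n(δ)`
there is an instance with 2 outcomes and `2n+1` actions where
`OPT(δ) - (OPT - 2√δ + δ) ≤ √δ / n`. -/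
theorem lower_bound_tightness (δ : ℝ) (hδ : δ ∈ Set.Ioo (0 : ℝ) 1) :
    ∃ N : ℕ, ∀ n : ℕ, N < n →
      ∃ I : PAInstance (Fin (2 * n + 1)) (Fin 2),
        I.OPTrob δ - (I.OPT - 2 * Real.sqrt δ + δ) ≤ Real.sqrt δ / (n : ℝ) := by
  refine ⟨0, fun n hn => ?_⟩
  have hs : 0 < Real.sqrt δ := Real.sqrt_pos.mpr hδ.1
  have hsq : Real.sqrt δ ^ 2 = δ := Real.sq_sqrt hδ.1.le
  have h₀ : successGrid (Real.sqrt δ) n (Fin.last _) = 0 := by simp [successGrid]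
  have h₁ : successGrid (Real.sqrt δ) n 0 = 1 := by
    simp [successGrid, (show n ≠ 0 by omega)]
  refine ⟨.ofSuccessProb _ (successGrid_mem hs.le n) _ h₀, ?_⟩
  have hOPT := PAInstance.one_le_OPT_ofSuccessProb _ (successGrid_mem hs.le n) _ h₀ h₁
  have hrob := PAInstance.OPTrob_ofSuccessProb_le _ (successGrid_mem hs.le n) _ h₀
    (δ := δ) (T := (1 - Real.sqrt δ) ^ 2 + Real.sqrt δ / n) hδ.1 (by positivity) h₁
    (fun α hα hα1 => by simpa only [hsq] using exists_successGrid hs hn hα hα1)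
  nlinarith
end

section
/- Consider the instance of the hidden-action principal-agent problem with two outcomes ω₁, ω₂, reward vector r = (0,1), and two actions a₁, a₂ with F_{a₁} = (1,0), F_{a₂} = (0,1), and costs c_{a₁} = c_{a₂} = 0. Then SW = 1 and, for every δ ∈ (0,1), OPT(δ) = 1 − δ = SW − δ, so the upper bound OPT(δ) ≤ max{0, SW − δ} is attained with equality. -/
open scoped BigOperators

namespace PAInstance

/-- The robust utility of a contract is at most the utility from any `δ`-best response. -/
theorem Psi_le_uP {A O : Type*} [Fintype A] [Fintype O] [Nonempty A] [Nonempty O]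
    (I : PAInstance A O) {δ : ℝ} {p : O → ℝ} {a : A} (ha : a ∈ I.dBR δ p) :
    I.Psi δ p ≤ I.uP p a :=
  csInf_le (Set.toFinite _).bddBelow (Set.mem_image_of_mem _ ha)

end PAInstance

/-- In the 2-action, 2-outcome instance with `F_{a₁} = (1,0)`,
`F_{a₂} = (0,1)`, `r = (0,1)`, zero costs, one has `SW = 1` and
`OPT(δ) = 1 - δ = SW - δ` for every δ ∈ (0,1). -/
theorem upper_bound_tightness (I : PAInstance (Fin 2) (Fin 2))
    (hF : I.F = fun a ω => if a = ω then 1 else 0)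
    (hr : I.r = ![0, 1])
    (hc : I.c = fun _ => 0) :
    I.SW = 1 ∧ ∀ δ ∈ Set.Ioo (0 : ℝ) 1, I.OPTrob δ = 1 - δ ∧ I.OPTrob δ = I.SW - δ := by
  have huA (p : Fin 2 → ℝ) (a : Fin 2) : I.uA p a = p a := by
    simp [PAInstance.uA, hF, hc]
  have huP (p : Fin 2 → ℝ) (a : Fin 2) : I.uP p a = ![0, 1] a - p a := by
    simp [PAInstance.uP, hF, hr]
  have hSW : I.SW = 1 := by
    have h : IsGreatest (Set.range fun a => (∑ ω, I.F a ω * I.r ω) - I.c a) 1 := by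
      refine ⟨⟨1, by simp [hF, hr, hc]⟩, ?_⟩
      rintro _ ⟨a, rfl⟩
      fin_cases a <;> simp [hF, hr, hc]
    exact h.csSup_eq
  refine ⟨hSW, fun δ hδ => ?_⟩
  have hδ0 : 0 < δ := hδ.1
  have hOPT : IsGreatest {x | ∃ p, PAInstance.IsContract p ∧ x = I.Psi δ p} (1 - δ) := by
    constructor
    · refine ⟨![0, δ], ?_, ?_⟩
      · intro ω
        fin_cases ω <;> simp [hδ0.le]
      · have hBR : I.dBR δ ![0, δ] = {1} := by
          ext a
          fin_cases a <;> simp [PAInstance.dBR, huA, Fin.forall_fin_two, hδ0]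
        simp [PAInstance.Psi, hBR, huP]
    · rintro _ ⟨p, hp, rfl⟩
      by_cases h : p 1 - δ < p 0
      · have h0 : (0 : Fin 2) ∈ I.dBR δ p := by
          simp [PAInstance.dBR, huA, Fin.forall_fin_two, hδ0, h]
        have hle := I.Psi_le_uP h0
        simp only [huP, Matrix.cons_val_zero] at hle
        linarith [hp 0, hδ.2]
      · have h1 : (1 : Fin 2) ∈ I.dBR δ p := by
          simp only [PAInstance.dBR, huA, Fin.forall_fin_two, Set.mem_ofPred_eq]
          constructor <;> linarith
        have hle := I.Psi_le_uP h1
        simp only [huP, Matrix.cons_val_one, Matrix.cons_val_zero] at hle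
        linarith [hp 0]
  have hval : I.OPTrob δ = 1 - δ := hOPT.csSup_eq
  exact ⟨hval, by rw [hval, hSW]⟩
end

section
/- Fix δ ∈ (0,1), an optimal δ-robust contract p⋆ (i.e., Ψ_δ(p⋆) ≥ Ψ_δ(p) for all contracts p), a best response a⋆ ∈ A(p⋆), and a worst δ-best response a^δ ∈ argmin_{a ∈ A^δ(p⋆)} u^P(p⋆, a). Call a contract p feasible if for every action a ∈ A either u^A(p,a) ≤ u^A(p,a⋆) − δ or u^P(p,a) ≥ u^P(p,a^δ). Then every feasible contract p that maximizes u^P(·, a^δ) over the set of feasible contracts satisfies Ψ_δ(p) = Ψ_δ(p⋆), i.e., it is an optimal δ-robust contract. -/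
open scoped BigOperators

namespace PAInstance

variable {A O : Type*} [Fintype A] [Fintype O] [Nonempty A] [Nonempty O]

theorem BR_nonempty (I : PAInstance A O) (p : O → ℝ) : (I.BR p).Nonempty :=
  Finite.exists_max (I.uA p)

theorem BR_subset_dBR (I : PAInstance A O) {δ : ℝ} (hδ : 0 < δ) (p : O → ℝ) :
    I.BR p ⊆ I.dBR δ p :=
  fun _ ha a' => (sub_lt_self _ hδ).trans_le (ha a')

theorem le_Psi (I : PAInstance A O) {δ x : ℝ} (hδ : 0 < δ) {p : O → ℝ}
    (h : ∀ a ∈ I.dBR δ p, x ≤ I.uP p a) : x ≤ I.Psi δ p :=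
  le_csInf (((I.BR_nonempty p).mono (I.BR_subset_dBR hδ p)).image _)
    (Set.forall_mem_image.2 h)

theorem Psi_le (I : PAInstance A O) {δ : ℝ} {p : O → ℝ} {a : A} (ha : a ∈ I.dBR δ p) :
    I.Psi δ p ≤ I.uP p a :=
  csInf_le (Set.toFinite _).bddBelow (Set.mem_image_of_mem _ ha)

theorem le_sub_of_notMem_dBR (I : PAInstance A O) {δ : ℝ} {p : O → ℝ} {a b : A}
    (hb : b ∈ I.BR p) (ha : a ∉ I.dBR δ p) : I.uA p a ≤ I.uA p b - δ := by
  obtain ⟨a', ha'⟩ := not_forall.1 ha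
  exact (not_lt.1 ha').trans (sub_le_sub_right (hb a') δ)

end PAInstance

/-- Any contract maximizing `u^P(·, a^δ)` over the feasible set of
the disjunctive program is an optimal δ-robust contract. -/
theorem feasible_maximizer_is_optimal {A O : Type*} [Fintype A] [Fintype O]
    [Nonempty A] [Nonempty O]
    (I : PAInstance A O) (δ : ℝ) (hδ : δ ∈ Set.Ioo (0 : ℝ) 1)
    (pstar : O → ℝ) (hps : PAInstance.IsContract pstar)
    (hopt : ∀ p, PAInstance.IsContract p → I.Psi δ p ≤ I.Psi δ pstar)
    (astar : A) (hastar : astar ∈ I.BR pstar)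
    (adel : A) (hadel : adel ∈ I.dBR δ pstar)
    (hworst : ∀ a ∈ I.dBR δ pstar, I.uP pstar adel ≤ I.uP pstar a)
    (p : O → ℝ)
    (hfeas : PAInstance.IsContract p ∧
      ∀ a, I.uA p a ≤ I.uA p astar - δ ∨ I.uP p adel ≤ I.uP p a)
    (hmax : ∀ q : O → ℝ,
      (PAInstance.IsContract q ∧
        ∀ a, I.uA q a ≤ I.uA q astar - δ ∨ I.uP q adel ≤ I.uP q a) →
      I.uP q adel ≤ I.uP p adel) :
    I.Psi δ p = I.Psi δ pstar := by
  refine le_antisymm (hopt p hfeas.1) ((I.Psi_le hadel).trans ?_)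
  have hle : I.uP pstar adel ≤ I.uP p adel := by
    refine hmax pstar ⟨hps, fun a => ?_⟩
    by_cases ha : a ∈ I.dBR δ pstar
    · exact Or.inr (hworst a ha)
    · exact Or.inl (I.le_sub_of_notMem_dBR hastar ha)
  exact hle.trans (I.le_Psi hδ.1 fun a ha => (hfeas.2 a).resolve_left (not_le.2 (ha astar)))
end

section
/- Consider a hidden-action principal-agent problem with a finite set Θ of agent types and a distribution λ ∈ Δ(Θ), with contracts restricted to the hypercube C = [0,1]^m. For every δ ∈ (0,1), OPT(C, δ) ≥ OPT(C) − 2√δ, where OPT(C, δ) = max_{p ∈ C} Σ_{θ∈Θ} λ_θ · u^P(p, a^{θ,δ}(p), θ) is the optimal δ-robust value over C and OPT(C) = max_{p ∈ C} Σ_{θ∈Θ} λ_θ · u^P(p, a^θ(p), θ) is the optimal non-robust value over C. -/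
open scoped BigOperators

/-- A hidden-action principal-agent problem with a finite set `Θ` of agent
types distributed according to `lam`. -/
structure TypedPAInstance (A O Θ : Type*) [Fintype A] [Fintype O] [Fintype Θ]
    [Nonempty A] [Nonempty O] [Nonempty Θ] where
  /-- `F θ a ω` is the probability that action `a` of type `θ` yields outcome `ω`. -/
  F : Θ → A → O → ℝ
  /-- principal's reward vector -/
  r : O → ℝ
  /-- agent's cost vector, per type -/
  c : Θ → A → ℝ
  /-- distribution over types -/
  lam : Θ → ℝ
  F_nonneg : ∀ θ a ω, 0 ≤ F θ a ω
  F_sum : ∀ θ a, ∑ ω, F θ a ω = 1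
  r_mem : ∀ ω, r ω ∈ Set.Icc (0 : ℝ) 1
  c_mem : ∀ θ a, c θ a ∈ Set.Icc (0 : ℝ) 1
  lam_nonneg : ∀ θ, 0 ≤ lam θ
  lam_sum : ∑ θ, lam θ = 1
  /-- the opt-out action -/
  optOut : A
  optOut_cost : ∀ θ, c θ optOut = 0
  optOut_reward : ∀ θ, ∑ ω, F θ optOut ω * r ω = 0

namespace TypedPAInstance

variable {A O Θ : Type*} [Fintype A] [Fintype O] [Fintype Θ]
  [Nonempty A] [Nonempty O] [Nonempty Θ]

/-- Agent's expected utility `u^A(p, a, θ)`. -/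
def uA (I : TypedPAInstance A O Θ) (θ : Θ) (p : O → ℝ) (a : A) : ℝ :=
  (∑ ω, I.F θ a ω * p ω) - I.c θ a

/-- Principal's expected utility `u^P(p, a, θ)`. -/
def uP (I : TypedPAInstance A O Θ) (θ : Θ) (p : O → ℝ) (a : A) : ℝ :=
  ∑ ω, I.F θ a ω * (I.r ω - p ω)

/-- Best responses `A^θ(p)` of type `θ`. -/
def BR (I : TypedPAInstance A O Θ) (θ : Θ) (p : O → ℝ) : Set A :=
  {a | ∀ a', I.uA θ p a' ≤ I.uA θ p a}

/-- δ-best responses `A^{θ,δ}(p)` of type `θ`. -/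
def dBR (I : TypedPAInstance A O Θ) (θ : Θ) (δ : ℝ) (p : O → ℝ) : Set A :=
  {a | ∀ a', I.uA θ p a' - δ < I.uA θ p a}

/-- The principal's expected utility `∑_θ λ_θ u^P(p, a^{θ,δ}(p), θ)` when each
type plays the worst δ-best response. -/
noncomputable def robVal (I : TypedPAInstance A O Θ) (δ : ℝ) (p : O → ℝ) : ℝ :=
  ∑ θ, I.lam θ * sInf (I.uP θ p '' I.dBR θ δ p)

/-- `OPT(C, δ)`: the optimal δ-robust value over the hypercube `C = [0,1]^m`. -/
noncomputable def OPTrobC (I : TypedPAInstance A O Θ) (δ : ℝ) : ℝ :=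
  sSup {x | ∃ p : O → ℝ, (∀ ω, p ω ∈ Set.Icc (0 : ℝ) 1) ∧ x = I.robVal δ p}

/-- The principal's expected utility `∑_θ λ_θ u^P(p, a^θ(p), θ)` when each type
plays a best response breaking ties in favor of the principal. -/
noncomputable def nonRobVal (I : TypedPAInstance A O Θ) (p : O → ℝ) : ℝ :=
  ∑ θ, I.lam θ * sSup (I.uP θ p '' I.BR θ p)

/-- `OPT(C)`: the optimal non-robust value over the hypercube `C = [0,1]^m`. -/
noncomputable def OPTC (I : TypedPAInstance A O Θ) : ℝ :=
  sSup {x | ∃ p : O → ℝ, (∀ ω, p ω ∈ Set.Icc (0 : ℝ) 1) ∧ x = I.nonRobVal p}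

end TypedPAInstance

namespace TypedPAInstance

variable {A O Θ : Type*} [Fintype A] [Fintype O] [Fintype Θ]
  [Nonempty A] [Nonempty O] [Nonempty Θ]

lemma BR_nonempty (I : TypedPAInstance A O Θ) (θ : Θ) (p : O → ℝ) : (I.BR θ p).Nonempty :=
  Finite.exists_max (I.uA θ p)

lemma BR_subset_dBR (I : TypedPAInstance A O Θ) (θ : Θ) {δ : ℝ} (hδ : 0 < δ) (p : O → ℝ) :
    I.BR θ p ⊆ I.dBR θ δ p := fun a ha a' => by
  have := ha a'
  linarith

lemma dBR_nonempty (I : TypedPAInstance A O Θ) (θ : Θ) {δ : ℝ} (hδ : 0 < δ) (p : O → ℝ) :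
    (I.dBR θ δ p).Nonempty :=
  (I.BR_nonempty θ p).mono (I.BR_subset_dBR θ hδ p)

lemma uP_le_one (I : TypedPAInstance A O Θ) (θ : Θ) {p : O → ℝ} (hp : ∀ ω, 0 ≤ p ω) (a : A) :
    I.uP θ p a ≤ 1 := by
  rw [← I.F_sum θ a]
  refine Finset.sum_le_sum fun ω _ => mul_le_of_le_one_right (I.F_nonneg θ a ω) ?_
  linarith [(I.r_mem ω).2, hp ω]

/-- Shifting a contract towards the reward vector scales the principal's utility. -/
lemma uP_shift (I : TypedPAInstance A O Θ) (θ : Θ) (s : ℝ) (p : O → ℝ) (a : A) :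
    I.uP θ (fun ω => (1 - s) * p ω + s * I.r ω) a = (1 - s) * I.uP θ p a := by
  simp only [uP, Finset.mul_sum]
  exact Finset.sum_congr rfl fun ω _ => by ring

/-- Shifting a contract towards the reward vector passes a share of the principal's utility to the
agent. -/
lemma uA_shift (I : TypedPAInstance A O Θ) (θ : Θ) (s : ℝ) (p : O → ℝ) (a : A) :
    I.uA θ (fun ω => (1 - s) * p ω + s * I.r ω) a = I.uA θ p a + s * I.uP θ p a := by
  have h : ∑ ω, I.F θ a ω * ((1 - s) * p ω + s * I.r ω) =
      ∑ ω, I.F θ a ω * p ω + s * ∑ ω, I.F θ a ω * (I.r ω - p ω) := by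
    rw [Finset.mul_sum, ← Finset.sum_add_distrib]
    exact Finset.sum_congr rfl fun ω _ => by ring
  simp only [uA, uP, h]
  ring

lemma uP_sub_le_uP_shift (I : TypedPAInstance A O Θ) (θ : Θ) {s : ℝ} (hs0 : 0 < s) (hs1 : s ≤ 1)
    {p : O → ℝ} (hp : ∀ ω, 0 ≤ p ω) {a b : A} (hb : b ∈ I.BR θ p)
    (ha : a ∈ I.dBR θ (s ^ 2) (fun ω => (1 - s) * p ω + s * I.r ω)) :
    I.uP θ p b - 2 * s ≤ I.uP θ (fun ω => (1 - s) * p ω + s * I.r ω) a := by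
  have h1 := ha b
  have h2 := hb a
  rw [uA_shift, uA_shift] at h1
  rw [uP_shift]
  have h3 := I.uP_le_one θ hp b
  have h4 : I.uP θ p b - s ≤ I.uP θ p a := by
    refine le_of_mul_le_mul_left ?_ hs0
    nlinarith
  nlinarith [mul_le_mul_of_nonneg_left h4 (sub_nonneg.2 hs1), mul_le_mul_of_nonneg_left h3 hs0.le]

lemma sum_lam_mul_le_add (I : TypedPAInstance A O Θ) {f g : Θ → ℝ} {k : ℝ}
    (h : ∀ θ, f θ ≤ g θ + k) : ∑ θ, I.lam θ * f θ ≤ ∑ θ, I.lam θ * g θ + k := by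
  calc ∑ θ, I.lam θ * f θ ≤ ∑ θ, I.lam θ * (g θ + k) :=
        Finset.sum_le_sum fun θ _ => mul_le_mul_of_nonneg_left (h θ) (I.lam_nonneg θ)
    _ = ∑ θ, I.lam θ * g θ + k := by
        simp only [mul_add, Finset.sum_add_distrib, ← Finset.sum_mul, I.lam_sum, one_mul]

lemma nonRobVal_le_robVal_shift (I : TypedPAInstance A O Θ) {s : ℝ} (hs0 : 0 < s) (hs1 : s ≤ 1)
    {p : O → ℝ} (hp : ∀ ω, 0 ≤ p ω) :
    I.nonRobVal p ≤ I.robVal (s ^ 2) (fun ω => (1 - s) * p ω + s * I.r ω) + 2 * s := by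
  refine I.sum_lam_mul_le_add fun θ => csSup_le ((I.BR_nonempty θ p).image _) ?_
  rintro _ ⟨b, hb, rfl⟩
  rw [← sub_le_iff_le_add]
  refine le_csInf ((I.dBR_nonempty θ (pow_pos hs0 2) _).image _) ?_
  rintro _ ⟨a, ha, rfl⟩
  exact I.uP_sub_le_uP_shift θ hs0 hs1 hp hb ha

lemma robVal_le_one (I : TypedPAInstance A O Θ) {δ : ℝ} (hδ : 0 < δ) {p : O → ℝ}
    (hp : ∀ ω, 0 ≤ p ω) : I.robVal δ p ≤ 1 := by
  have h : I.robVal δ p ≤ ∑ θ, I.lam θ * (0 : ℝ) + 1 := by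
    refine I.sum_lam_mul_le_add (g := fun _ => 0) fun θ => ?_
    obtain ⟨a, ha⟩ := I.dBR_nonempty θ hδ p
    rw [zero_add]
    exact (csInf_le (Set.toFinite _).bddBelow (Set.mem_image_of_mem _ ha)).trans
      (I.uP_le_one θ hp a)
  simpa using h

end TypedPAInstance

/-- For every δ ∈ (0,1), `OPT(C, δ) ≥ OPT(C) - 2√δ`. -/
theorem robust_vs_nonrobust_hypercube {A O Θ : Type*} [Fintype A] [Fintype O] [Fintype Θ]
    [Nonempty A] [Nonempty O] [Nonempty Θ]
    (I : TypedPAInstance A O Θ) (δ : ℝ) (hδ : δ ∈ Set.Ioo (0 : ℝ) 1) :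
    I.OPTrobC δ ≥ I.OPTC - 2 * Real.sqrt δ := by
  obtain ⟨hδ0, hδ1⟩ := hδ
  have hs0 : 0 < Real.sqrt δ := Real.sqrt_pos.2 hδ0
  have hs1 : Real.sqrt δ ≤ 1 := Real.sqrt_le_one.2 hδ1.le
  rw [ge_iff_le, sub_le_iff_le_add]
  refine csSup_le ⟨_, fun _ => 0, fun _ => ⟨le_rfl, zero_le_one⟩, rfl⟩ ?_
  rintro _ ⟨p, hp, rfl⟩
  have key := I.nonRobVal_le_robVal_shift hs0 hs1 fun ω => (hp ω).1
  rw [Real.sq_sqrt hδ0.le] at key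
  refine key.trans (add_le_add ?_ le_rfl)
  refine le_csSup ⟨1, ?_⟩ ⟨_, fun ω => ?_, rfl⟩
  · rintro _ ⟨q, hq, rfl⟩
    exact I.robVal_le_one hδ0 fun ω => (hq ω).1
  · exact convex_Icc (0 : ℝ) 1 (hp ω) (I.r_mem ω) (sub_nonneg.2 hs1) hs0.le (by ring)
end
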